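/- Let Ω ⊂ ℝ² be a bounded open set with piecewise C¹ boundary, let c > 0, and let A ∈ C^∞(Ω̄; M_{2×2}^{sym}(ℝ)) satisfy A(x) ≥ c·Id (as quadratic forms) for all x ∈ Ω̄. Let h_n → 0⁺. Then there exist sequences v_n ∈ C^∞(Ω̄; ℝ) and w_n ∈ C^∞(Ω̄; ℝ²) such that: (1) sup_{Ω̄} ‖A − (½ ∇v_n ⊗ ∇v_n + sym ∇w_n)‖ → 0; (2) sup_{Ω̄} |v_n| → 0 and sup_{Ω̄} |w_n| → 0, both monotonically; (3) sup_n (sup_{Ω̄} |∇v_n| + sup_{Ω̄} |∇w_n|) ≤ K < ∞; and (4) h_n^{1/2} sup_{Ω̄} ‖∇²v_n‖ + h_n sup_{Ω̄} ‖∇²w_n‖ → 0. -/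

import Mathlib

open MeasureTheory Matrix Filter Set Topology

attribute [local instance] Matrix.frobeniusNormedAddCommGroup Matrix.frobeniusNormedSpace

/-- The gradient of a scalar function on `ℝ²`. -/
noncomputable def gradv (v : (Fin 2 → ℝ) → ℝ) (x : Fin 2 → ℝ) : Fin 2 → ℝ :=
  fun i => fderiv ℝ v x (Pi.single i 1)

/-- `∇v ⊗ ∇v`: the `2×2` matrix with entries `∂ᵢv ∂ⱼv`. -/
noncomputable def gradOuter (v : (Fin 2 → ℝ) → ℝ) (x : Fin 2 → ℝ) :
    Matrix (Fin 2) (Fin 2) ℝ :=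
  Matrix.of fun i j => gradv v x i * gradv v x j

/-- `sym ∇w = (∇w + (∇w)ᵀ)/2` for `w : ℝ² → ℝ²`. -/
noncomputable def symGrad (w : (Fin 2 → ℝ) → Fin 2 → ℝ) (x : Fin 2 → ℝ) :
    Matrix (Fin 2) (Fin 2) ℝ :=
  Matrix.of fun i j =>
    (fderiv ℝ w x (Pi.single j 1) i + fderiv ℝ w x (Pi.single i 1) j) / 2


/-- Positive smooth extension from a compact set. -/
lemma pos_ext {C : Set (Fin 2 → ℝ)} (hC : IsCompact C) (φ : (Fin 2 → ℝ) → ℝ)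
    (hφ : ContDiff ℝ (⊤ : ℕ∞) φ) (hp : ∀ x ∈ C, 0 < φ x) :
    ∃ ψ : (Fin 2 → ℝ) → ℝ, ContDiff ℝ (⊤ : ℕ∞) ψ ∧ (∀ x, 0 < ψ x) ∧ ∀ x ∈ C, ψ x = φ x := by
  have hcl : IsClosed {x | φ x ≤ 0} := isClosed_le hφ.continuous continuous_const
  have hd : Disjoint {x | φ x ≤ 0} C := by
    rw [Set.disjoint_left]
    intro x hx hxC
    exact absurd (hp x hxC) (not_lt.mpr hx)
  obtain ⟨f, hf, hr, h0, h1⟩ := exists_contMDiff_zero_iff_one_iff_of_isClosed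
    (modelWithCornersSelf ℝ (Fin 2 → ℝ)) (n := ⊤) hcl hC.isClosed hd
  have hf' : ContDiff ℝ (⊤ : ℕ∞) f := contMDiff_iff_contDiff.mp hf
  refine ⟨fun x => f x * φ x + (1 - f x), by fun_prop, ?_, ?_⟩
  · intro x
    have hx := hr (Set.mem_range_self x)
    show 0 < f x * φ x + (1 - f x)
    by_cases hle : φ x ≤ 0
    · have := (h0 x).1 hle
      rw [this]; norm_num
    · push Not at hle
      rcases eq_or_lt_of_le hx.1 with he | hl
      · rw [← he]; norm_num
      · have := mul_pos hl hle
        linarith [hx.2]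
  · intro x hx
    have := (h1 x).1 hx
    simp [this]

/-- A bound for continuous expressions with bounded parameters. -/
lemma par_bound {C : Set (Fin 2 → ℝ)} (hC : IsCompact C)
    (F : (Fin 2 → ℝ) × ℝ × ℝ × ℝ × ℝ → ℝ) (hF : Continuous F) :
    ∃ M : ℝ, 0 < M ∧ ∀ x ∈ C, ∀ s c t e : ℝ, |s| ≤ 1 → |c| ≤ 1 → |t| ≤ 1 → |e| ≤ 1 →
      |F (x, s, c, t, e)| ≤ M := by
  have hI : IsCompact (Set.Icc (-1 : ℝ) 1) := isCompact_Icc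
  obtain ⟨M, hM⟩ := (hC.prod (hI.prod (hI.prod (hI.prod hI)))).exists_bound_of_continuousOn
    hF.continuousOn
  refine ⟨max M 1, lt_max_of_lt_right one_pos, ?_⟩
  intro x hx s c t e hs hc ht he
  exact (hM (x, s, c, t, e) ⟨hx, abs_le.1 hs, abs_le.1 hc, abs_le.1 ht, abs_le.1 he⟩).trans
    (le_max_left _ _)

lemma gradv_contDiff {f : (Fin 2 → ℝ) → ℝ} (hf : ContDiff ℝ (⊤ : ℕ∞) f) (i : Fin 2) :
    ContDiff ℝ (⊤ : ℕ∞) (fun x => gradv f x i) := by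
  unfold gradv
  exact (hf.fderiv_right (by simp)).clm_apply contDiff_const

/-- approximable fields, coordinates -/
def Ach (C : Set (Fin 2 → ℝ)) (B : (Fin 2 → ℝ) → Fin 2 → Fin 2 → ℝ) : Prop :=
  ∃ K : ℝ, 0 ≤ K ∧ ∀ ε : ℝ, 0 < ε → ∃ (v : (Fin 2 → ℝ) → ℝ) (w : Fin 2 → (Fin 2 → ℝ) → ℝ),
    ContDiff ℝ (⊤ : ℕ∞) v ∧ (∀ j, ContDiff ℝ (⊤ : ℕ∞) (w j)) ∧
    ∀ x ∈ C, |v x| ≤ ε ∧ (∀ j, |w j x| ≤ ε) ∧ (∀ i, |gradv v x i| ≤ K) ∧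
      (∀ i j, |gradv (w j) x i| ≤ K) ∧
      ∀ i j, |B x i j - (1 / 2 * (gradv v x i * gradv v x j) +
        (gradv (w i) x j + gradv (w j) x i) / 2)| ≤ ε

lemma ach_zero (C : Set (Fin 2 → ℝ)) : Ach C 0 := by
  refine ⟨0, le_rfl, fun ε hε => ⟨fun _ => 0, fun _ _ => 0, contDiff_const,
    fun _ => contDiff_const, fun x _ => ?_⟩⟩
  simp [gradv, hε.le]

lemma gradv_v (a v : (Fin 2 → ℝ) → ℝ) (η : Fin 2 → ℝ)
    (ha : ContDiff ℝ (⊤ : ℕ∞) a) (hv : ContDiff ℝ (⊤ : ℕ∞) v) (l : ℝ) (hl : l ≠ 0)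
    (x : Fin 2 → ℝ) (i : Fin 2) :
    gradv (fun y => v y + l⁻¹ * (2 * a y * Real.sin (l * (η 0 * y 0 + η 1 * y 1)))) x i =
      gradv v x i + 2 * a x * Real.cos (l * (η 0 * x 0 + η 1 * x 1)) * η i +
        l⁻¹ * (2 * gradv a x i * Real.sin (l * (η 0 * x 0 + η 1 * x 1))) := by
  have h1 := (ha.differentiable (by simp) x).hasFDerivAt
  have h2 := (hv.differentiable (by simp) x).hasFDerivAt
  have hp (k : Fin 2) : HasFDerivAt (fun y : Fin 2 → ℝ => y k)
    (ContinuousLinearMap.proj k : (Fin 2 → ℝ) →L[ℝ] ℝ) x := hasFDerivAt_apply k x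
  have ht := (((hp 0).const_mul (η 0)).add ((hp 1).const_mul (η 1))).const_mul l
  have := h2.add (((h1.const_mul 2).mul ht.sin).const_mul l⁻¹)
  have e := this.fderiv
  unfold gradv
  refine (congrArg (fun L => L (Pi.single i 1)) e).trans ?_
  fin_cases i <;> simp <;> field_simp <;> ring

lemma gradv_w (a u d : (Fin 2 → ℝ) → ℝ) (η : Fin 2 → ℝ) (b : ℝ)
    (ha : ContDiff ℝ (⊤ : ℕ∞) a) (hu : ContDiff ℝ (⊤ : ℕ∞) u) (hd : ContDiff ℝ (⊤ : ℕ∞) d)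
    (l : ℝ) (hl : l ≠ 0) (x : Fin 2 → ℝ) (i : Fin 2) :
    gradv (fun y => u y - l⁻¹ * (2 * a y * Real.sin (l * (η 0 * y 0 + η 1 * y 1)) * d y) -
        l⁻¹ * (a y * a y * Real.sin (2 * l * (η 0 * y 0 + η 1 * y 1)) * (b / 2))) x i =
      gradv u x i - 2 * a x * Real.cos (l * (η 0 * x 0 + η 1 * x 1)) * η i * d x -
        a x ^ 2 * Real.cos (2 * l * (η 0 * x 0 + η 1 * x 1)) * η i * b -
        l⁻¹ * (2 * Real.sin (l * (η 0 * x 0 + η 1 * x 1)) *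
            (gradv a x i * d x + a x * gradv d x i) +
          a x * gradv a x i * Real.sin (2 * l * (η 0 * x 0 + η 1 * x 1)) * b) := by
  have h1 := (ha.differentiable (by simp) x).hasFDerivAt
  have h2 := (hu.differentiable (by simp) x).hasFDerivAt
  have h3 := (hd.differentiable (by simp) x).hasFDerivAt
  have hp (k : Fin 2) : HasFDerivAt (fun y : Fin 2 → ℝ => y k)
    (ContinuousLinearMap.proj k : (Fin 2 → ℝ) →L[ℝ] ℝ) x := hasFDerivAt_apply k x
  have hs := ((hp 0).const_mul (η 0)).add ((hp 1).const_mul (η 1))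
  have ht := hs.const_mul l
  have ht2 := hs.const_mul (2 * l)
  have := (h2.sub ((((h1.const_mul 2).mul ht.sin).mul h3).const_mul l⁻¹)).sub
    ((((h1.mul h1).mul ht2.sin).mul_const (b / 2)).const_mul l⁻¹)
  have e := this.fderiv
  unfold gradv
  refine (congrArg (fun L => L (Pi.single i 1)) e).trans ?_
  fin_cases i <;> simp <;> field_simp <;> ring


lemma par_small {C : Set (Fin 2 → ℝ)} (hC : IsCompact C)
    (F : (Fin 2 → ℝ) × ℝ × ℝ × ℝ × ℝ → ℝ) (hF : Continuous F) (δ : ℝ) (hδ : 0 < δ) :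
    ∀ᶠ l : ℝ in atTop, ∀ x ∈ C, ∀ s c t : ℝ, |s| ≤ 1 → |c| ≤ 1 → |t| ≤ 1 →
      |l⁻¹ * F (x, s, c, t, l⁻¹)| ≤ δ := by
  obtain ⟨M, hM, hb⟩ := par_bound hC F hF
  filter_upwards [eventually_ge_atTop 1, eventually_ge_atTop (M / δ)] with l h1 h2
  intro x hx s c t hs hc ht
  have hl : 0 < l := by linarith
  have hli : |l⁻¹| ≤ 1 := by
    rw [abs_of_pos (inv_pos.2 hl)]
    exact inv_le_one_of_one_le₀ h1
  have := hb x hx s c t _ hs hc ht hli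
  rw [abs_mul, abs_of_pos (inv_pos.2 hl), inv_mul_le_iff₀ hl]
  rw [div_le_iff₀ hδ] at h2
  linarith

lemma ach_step {C : Set (Fin 2 → ℝ)} (hC : IsCompact C) (B : (Fin 2 → ℝ) → Fin 2 → Fin 2 → ℝ)
    (hB : Ach C B) (a : (Fin 2 → ℝ) → ℝ) (ha : ContDiff ℝ (⊤ : ℕ∞) a) (η : Fin 2 → ℝ) :
    Ach C (B + fun x i j => a x ^ 2 * η i * η j) := by
  obtain ⟨K, hK0, hK⟩ := hB
  have hac : Continuous a := ha.continuous
  have hM1 (i : Fin 2) : ∃ M : ℝ, 0 < M ∧ ∀ x ∈ C, |a x * η i| ≤ M := by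
    obtain ⟨M, h0, h⟩ := par_bound hC (fun p => a p.1 * η i) (by fun_prop)
    exact ⟨M, h0, fun x hx => h x hx 0 0 0 0 (by simp) (by simp) (by simp) (by simp)⟩
  choose N hN0 hN using hM1
  set M : ℝ := N 0 + N 1 with hMdef
  have hMb : ∀ x ∈ C, ∀ i, |a x * η i| ≤ M := by
    intro x hx i
    have h0 := hN0 0
    have h1 := hN0 1
    fin_cases i
    · exact (hN 0 x hx).trans (by linarith)
    · exact (hN 1 x hx).trans (by linarith)
  have hM0 : 0 ≤ M := by linarith [hN0 0, hN0 1]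
  refine ⟨K + 2 * M + 2 * M * K + M ^ 2 + 1, by positivity, fun ε hε => ?_⟩
  obtain ⟨v, w, hv, hw, hvw⟩ := hK (ε / 2) (by linarith)
  have hd := fun j => gradv_contDiff hv j
  have hdc := fun j => (gradv_contDiff hv j).continuous
  have hec := fun j => (gradv_contDiff ha j).continuous
  have hddc := fun i j => (gradv_contDiff (hd j) i).continuous
  set d : Fin 2 → (Fin 2 → ℝ) → ℝ := fun j x => gradv v x j with hddef
  set e : Fin 2 → (Fin 2 → ℝ) → ℝ := fun j x => gradv a x j with hedef
  set dd : Fin 2 → Fin 2 → (Fin 2 → ℝ) → ℝ := fun i j x => gradv (d j) x i with hdddef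
  have hdc' : ∀ j, Continuous (d j) := hdc
  have hec' : ∀ j, Continuous (e j) := hec
  have hddc' : ∀ i j, Continuous (dd i j) := hddc
  have hε2 : 0 < ε / 2 := by linarith
  have E0 := par_small hC (fun p => 2 * a p.1 * p.2.1) (by fun_prop) (ε / 2) hε2
  have E1 : ∀ᶠ l : ℝ in atTop, ∀ j, _ := eventually_all.2 fun j : Fin 2 => par_small hC
    (fun p => 2 * a p.1 * p.2.1 * d j p.1 + a p.1 * a p.1 * p.2.2.2.1 * (η j / 2))
    (by fun_prop) (ε / 2) hε2
  have E2 : ∀ᶠ l : ℝ in atTop, ∀ j, _ := eventually_all.2 fun j : Fin 2 => par_small hC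
    (fun p => 2 * e j p.1 * p.2.1) (by fun_prop) 1 one_pos
  have E3 : ∀ᶠ l : ℝ in atTop, ∀ i j, _ := eventually_all.2 fun i : Fin 2 =>
    eventually_all.2 fun j : Fin 2 => par_small hC
    (fun p => 2 * p.2.1 * (e i p.1 * d j p.1 + a p.1 * dd i j p.1) +
      a p.1 * e i p.1 * p.2.2.2.1 * η j) (by fun_prop) 1 one_pos
  have E4 : ∀ᶠ l : ℝ in atTop, ∀ i j, _ := eventually_all.2 fun i : Fin 2 =>
    eventually_all.2 fun j : Fin 2 => par_small hC
    (fun p => p.2.1 * (e i p.1 * (d j p.1 + 2 * a p.1 * p.2.2.1 * η j) +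
        e j p.1 * (d i p.1 + 2 * a p.1 * p.2.2.1 * η i)) +
      2 * p.2.2.2.2 * e i p.1 * e j p.1 * p.2.1 ^ 2 -
      ((2 * p.2.1 * (e i p.1 * d j p.1 + a p.1 * dd i j p.1) +
      a p.1 * e i p.1 * p.2.2.2.1 * η j) + (2 * p.2.1 * (e j p.1 * d i p.1 + a p.1 * dd j i p.1) +
      a p.1 * e j p.1 * p.2.2.2.1 * η i)) / 2) (by fun_prop) (ε / 2) hε2
  obtain ⟨l, hl1, E0, E1, E2, E3, E4⟩ :=
    ((eventually_ge_atTop (1 : ℝ)).and (E0.and (E1.and (E2.and (E3.and E4))))).exists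
  have hl : l ≠ 0 := by linarith
  refine ⟨fun y => v y + l⁻¹ * (2 * a y * Real.sin (l * (η 0 * y 0 + η 1 * y 1))),
    fun j y => w j y - l⁻¹ * (2 * a y * Real.sin (l * (η 0 * y 0 + η 1 * y 1)) * d j y) -
        l⁻¹ * (a y * a y * Real.sin (2 * l * (η 0 * y 0 + η 1 * y 1)) * (η j / 2)),
    by fun_prop, ?_, ?_⟩
  · intro j
    have h1 := hw j
    have h2 : ContDiff ℝ (⊤ : ℕ∞) (d j) := hd j
    fun_prop
  intro x hx
  obtain ⟨b0, b1, b2, b3, b4⟩ := hvw x hx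
  have gv := fun i => gradv_v a v η ha hv l hl x i
  have gw := fun i j => gradv_w a (w j) (d j) η (η j) ha (hw j) (hd j) l hl x i
  simp only [gv, gw]
  have hcos : Real.cos (2 * l * (η 0 * x 0 + η 1 * x 1)) =
    2 * Real.cos (l * (η 0 * x 0 + η 1 * x 1)) ^ 2 - 1 := by
    rw [mul_assoc, Real.cos_two_mul]
  have hs1 := Real.abs_sin_le_one (l * (η 0 * x 0 + η 1 * x 1))
  have hc1 := Real.abs_cos_le_one (l * (η 0 * x 0 + η 1 * x 1))
  have ht1 := Real.abs_sin_le_one (2 * l * (η 0 * x 0 + η 1 * x 1))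
  have hC2 := Real.abs_cos_le_one (2 * l * (η 0 * x 0 + η 1 * x 1))
  set s := Real.sin (l * (η 0 * x 0 + η 1 * x 1))
  set c := Real.cos (l * (η 0 * x 0 + η 1 * x 1))
  set t := Real.sin (2 * l * (η 0 * x 0 + η 1 * x 1))
  set c2 := Real.cos (2 * l * (η 0 * x 0 + η 1 * x 1))
  replace E0 := E0 x hx s c t hs1 hc1 ht1
  replace E1 := fun j => E1 j x hx s c t hs1 hc1 ht1
  replace E2 := fun j => E2 j x hx s c t hs1 hc1 ht1
  replace E3 := fun i j => E3 i j x hx s c t hs1 hc1 ht1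
  replace E4 := fun i j => E4 i j x hx s c t hs1 hc1 ht1
  simp only at E0 E1 E2 E3 E4
  have hMx := hMb x hx
  have key : ∀ i, |2 * a x * c * η i| ≤ 2 * M := by
    intro i
    have : 2 * a x * c * η i = 2 * (c * (a x * η i)) := by ring
    rw [this, abs_mul, abs_mul, abs_two]
    have := mul_le_mul hc1 (hMx i) (abs_nonneg _) zero_le_one
    linarith
  refine ⟨?_, ?_, ?_, ?_, ?_⟩
  · have := abs_add_le (v x) (l⁻¹ * (2 * a x * s))
    linarith
  · intro j
    have h1 := E1 j
    have h2 := b1 j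
    have : w j x - l⁻¹ * (2 * a x * s * d j x) - l⁻¹ * (a x * a x * t * (η j / 2)) =
      w j x - l⁻¹ * (2 * a x * s * d j x + a x * a x * t * (η j / 2)) := by ring
    rw [this]
    have := abs_sub (w j x) (l⁻¹ * (2 * a x * s * d j x + a x * a x * t * (η j / 2)))
    linarith
  · intro i
    have h1 := E2 i
    have h2 := b2 i
    have h3 := key i
    have h4 := abs_add_three (gradv v x i) (2 * a x * c * η i) (l⁻¹ * (2 * e i x * s))
    have : 0 ≤ 2 * M * K + M ^ 2 := by positivity
    exact h4.trans (by linarith)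
  · intro i j
    have h1 := E3 i j
    have h2 := b3 i j
    have h3 : |2 * a x * c * η i * d j x| ≤ 2 * M * K := by
      rw [abs_mul]
      exact mul_le_mul (key i) (b2 j) (abs_nonneg _) (by positivity)
    have h4 : |a x ^ 2 * c2 * η i * η j| ≤ M ^ 2 := by
      have : a x ^ 2 * c2 * η i * η j = c2 * ((a x * η i) * (a x * η j)) := by ring
      rw [this, abs_mul, abs_mul]
      have h5 := mul_le_mul (hMx i) (hMx j) (abs_nonneg _) hM0
      have h6 := mul_le_mul hC2 h5 (by positivity) zero_le_one
      linarith
    have h5 := abs_sub (gradv (w j) x i - 2 * a x * c * η i * d j x - a x ^ 2 * c2 * η i * η j)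
      (l⁻¹ * (2 * s * (e i x * d j x + a x * dd i j x) + a x * e i x * t * η j))
    have h6 := abs_sub (gradv (w j) x i - 2 * a x * c * η i * d j x) (a x ^ 2 * c2 * η i * η j)
    have h7 := abs_sub (gradv (w j) x i) (2 * a x * c * η i * d j x)
    exact h5.trans (by linarith)
  · intro i j
    have h1 := b4 i j
    have h2 := E4 i j
    have h3 := (abs_sub _ _).trans (add_le_add h1 h2)
    rw [add_halves] at h3
    refine le_trans (le_of_eq ?_) h3
    congr 1
    have r1 : ∀ i, gradv v x i = d i x := fun _ => rfl
    have r2 : ∀ i, gradv a x i = e i x := fun _ => rfl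
    have r3 : ∀ i j, gradv (d j) x i = dd i j x := fun _ _ => rfl
    simp only [r1, r2, r3, Pi.add_apply, hcos]
    ring


lemma ach_congr {C : Set (Fin 2 → ℝ)} {B B' : (Fin 2 → ℝ) → Fin 2 → Fin 2 → ℝ}
    (hB : Ach C B) (he : ∀ x ∈ C, ∀ i j, B' x i j = B x i j) : Ach C B' := by
  obtain ⟨K, h0, hK⟩ := hB
  refine ⟨K, h0, fun ε hε => ?_⟩
  obtain ⟨v, w, hv, hw, h⟩ := hK ε hε
  refine ⟨v, w, hv, hw, fun x hx => ?_⟩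
  obtain ⟨b0, b1, b2, b3, b4⟩ := h x hx
  exact ⟨b0, b1, b2, b3, fun i j => by rw [he x hx]; exact b4 i j⟩

/-- Finite sums of primitive fields. -/
def Prim : AddSubmonoid ((Fin 2 → ℝ) → Fin 2 → Fin 2 → ℝ) :=
  AddSubmonoid.closure {B | ∃ (a : (Fin 2 → ℝ) → ℝ) (η : Fin 2 → ℝ),
    ContDiff ℝ (⊤ : ℕ∞) a ∧ B = fun x i j => a x ^ 2 * η i * η j}

lemma prim_gen (a : (Fin 2 → ℝ) → ℝ) (ha : ContDiff ℝ (⊤ : ℕ∞) a) (η : Fin 2 → ℝ) :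
    (fun x i j => a x ^ 2 * η i * η j) ∈ Prim :=
  AddSubmonoid.subset_closure ⟨a, η, ha, rfl⟩

lemma prim_pos (φ : (Fin 2 → ℝ) → ℝ) (hφ : ContDiff ℝ (⊤ : ℕ∞) φ) (hp : ∀ x, 0 < φ x)
    (η : Fin 2 → ℝ) : (fun x i j => φ x * η i * η j) ∈ Prim := by
  have := prim_gen (fun x => Real.sqrt (φ x)) (hφ.sqrt fun x => (hp x).ne') η
  simpa only [Real.sq_sqrt (hp _).le] using this

lemma ach_of_prim {C : Set (Fin 2 → ℝ)} (hC : IsCompact C)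
    {B : (Fin 2 → ℝ) → Fin 2 → Fin 2 → ℝ} (hB : B ∈ Prim) : Ach C B := by
  unfold Prim at hB
  induction hB using AddSubmonoid.closure_induction_right with
  | zero => exact ach_zero C
  | add_right B hB B' hB' ih =>
    obtain ⟨a, η, ha, rfl⟩ := hB'
    exact ach_step hC B ih a ha η

lemma prim_const (f : (Fin 2 → ℝ) → ℝ) (hf : ContDiff ℝ (⊤ : ℕ∞) f) (p q r : ℝ) (hp : 0 < p)
    (hd : 0 ≤ p * r - q ^ 2) :
    (fun x (i j : Fin 2) => f x ^ 2 * !![p, q; q, r] i j) ∈ Prim := by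
  have h1 := prim_gen (fun x => f x * Real.sqrt p) (by fun_prop) ![1, q / p]
  have h2 := prim_gen (fun x => f x * Real.sqrt ((p * r - q ^ 2) / p)) (by fun_prop) ![0, 1]
  convert add_mem h1 h2 using 1
  funext x i j
  have e1 := Real.sq_sqrt hp.le
  have e2 := Real.sq_sqrt (div_nonneg hd hp.le)
  simp only [Pi.add_apply, mul_pow, e1, e2]
  fin_cases i <;> fin_cases j <;> simp <;> field_simp
  ring

lemma exists_decomp {C : Set (Fin 2 → ℝ)} (hC : IsCompact C) (c : ℝ) (hc : 0 < c)
    (p q r : (Fin 2 → ℝ) → ℝ) (hp : ContDiff ℝ (⊤ : ℕ∞) p) (hq : ContDiff ℝ (⊤ : ℕ∞) q)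
    (hr : ContDiff ℝ (⊤ : ℕ∞) r)
    (hpos : ∀ x ∈ C, ∀ s t : ℝ, c * (s ^ 2 + t ^ 2) ≤ p x * s ^ 2 + 2 * q x * s * t + r x * t ^ 2) :
    Ach C (fun x i j => !![p x, q x; q x, r x] i j) := by
  have hpc := hp.continuous
  have hqc := hq.continuous
  have hrc := hr.continuous
  have hball : ∀ x : Fin 2 → ℝ, ∃ R : ℝ, 0 < R ∧ ∀ y ∈ Metric.ball x R,
      |p y - p x| ≤ c / 8 ∧ |q y - q x| ≤ c / 8 ∧ |r y - r x| ≤ c / 8 := by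
    intro x
    have aux : ∀ g : (Fin 2 → ℝ) → ℝ, Continuous g → ∀ᶠ y in 𝓝 x, |g y - g x| ≤ c / 8 := by
      intro g hg
      filter_upwards [hg.continuousAt (Metric.closedBall_mem_nhds (g x) (by positivity : 0 < c / 8))]
        with y hy
      simpa [Real.dist_eq] using hy
    obtain ⟨R, hR, h⟩ := Metric.eventually_nhds_iff_ball.1
      ((aux p hpc).and ((aux q hqc).and (aux r hrc)))
    exact ⟨R, hR, h⟩
  choose R hR hRb using hball
  let f : (x : Fin 2 → ℝ) → ContDiffBump x := fun x => ⟨R x / 2, R x, by linarith [hR x], by linarith [hR x]⟩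
  have hfs : ∀ x y, y ∉ Metric.ball x (R x) → f x y = 0 := by
    intro x y hy
    have := (f x).support_eq
    by_contra hne
    have : y ∈ Function.support (f x) := hne
    rw [(f x).support_eq] at this
    exact hy this
  have hfp : ∀ x y, y ∈ Metric.ball x (R x) → 0 < f x y := fun x y hy => (f x).pos_of_mem_ball hy
  have hfd : ∀ x, ContDiff ℝ (⊤ : ℕ∞) (f x) := fun x => (f x).contDiff
  obtain ⟨T, hTC, hT⟩ := hC.elim_nhds_subcover (fun x => Metric.ball x (R x))
    (fun x _ => Metric.ball_mem_nhds x (hR x))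
  have hφd : ContDiff ℝ (⊤ : ℕ∞) (fun y => ∑ x ∈ T, f x y ^ 2) :=
    ContDiff.sum fun x _ => (hfd x).pow 2
  obtain ⟨ψ, hψ, hψp, hψe⟩ := pos_ext hC _ hφd (by
    intro y hy
    obtain ⟨x, hx, hxy⟩ := Set.mem_iUnion₂.1 (hT hy)
    exact Finset.sum_pos' (fun _ _ => sq_nonneg _) ⟨x, hx, pow_pos (hfp x y hxy) 2⟩)
  let χ : (Fin 2 → ℝ) → (Fin 2 → ℝ) → ℝ := fun x y => (f x y / Real.sqrt (ψ y))
  have hχd : ∀ x, ContDiff ℝ (⊤ : ℕ∞) (χ x) := fun x =>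
    (hfd x).div (hψ.sqrt fun y => (hψp y).ne') fun y => (Real.sqrt_pos.2 (hψp y)).ne'
  have hχsum : ∀ y ∈ C, ∑ x ∈ T, χ x y ^ 2 = 1 := by
    intro y hy
    have : ∀ x, χ x y ^ 2 = f x y ^ 2 / ψ y := by
      intro x
      simp only [χ, div_pow, Real.sq_sqrt (hψp y).le]
    simp only [this]
    rw [← Finset.sum_div, ← hψe y hy, div_self (hψp y).ne']
  have hχz : ∀ x y, y ∉ Metric.ball x (R x) → χ x y = 0 := by
    intro x y hy
    simp [χ, hfs x y hy]
  have havg : ∀ (g : (Fin 2 → ℝ) → ℝ), (∀ x, ∀ y ∈ Metric.ball x (R x), |g y - g x| ≤ c / 8) →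
      ∀ (k : ℝ), ∀ y ∈ C, |g y - k - ∑ x ∈ T, χ x y ^ 2 * (g x - k)| ≤ c / 8 := by
    intro g hg k y hy
    have : g y - k - ∑ x ∈ T, χ x y ^ 2 * (g x - k) = ∑ x ∈ T, χ x y ^ 2 * (g y - g x) := by
      have h1 : ∑ x ∈ T, χ x y ^ 2 * (g y - g x) =
        (∑ x ∈ T, χ x y ^ 2) * (g y - k) - ∑ x ∈ T, χ x y ^ 2 * (g x - k) := by
        rw [Finset.sum_mul, ← Finset.sum_sub_distrib]
        exact Finset.sum_congr rfl fun x _ => by ring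
      rw [h1, hχsum y hy]; ring
    rw [this]
    calc _ ≤ ∑ x ∈ T, |χ x y ^ 2 * (g y - g x)| := Finset.abs_sum_le_sum_abs _ _
      _ ≤ ∑ x ∈ T, χ x y ^ 2 * (c / 8) := by
        refine Finset.sum_le_sum fun x _ => ?_
        rw [abs_mul, abs_of_nonneg (sq_nonneg _)]
        by_cases hb : y ∈ Metric.ball x (R x)
        · exact mul_le_mul_of_nonneg_left (hg x y hb) (sq_nonneg _)
        · simp [hχz x y hb]
      _ = c / 8 := by rw [← Finset.sum_mul, hχsum y hy, one_mul]
  have hP := havg p (fun x y hy => (hRb x y hy).1) (c / 2)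
  have hQ := havg q (fun x y hy => (hRb x y hy).2.1) 0
  have hRr := havg r (fun x y hy => (hRb x y hy).2.2) (c / 2)
  have hSd : ∀ (g : (Fin 2 → ℝ) → ℝ) (k : ℝ), ContDiff ℝ (⊤ : ℕ∞) g →
      ContDiff ℝ (⊤ : ℕ∞) (fun y => g y - k - ∑ x ∈ T, χ x y ^ 2 * (g x - k)) := by
    intro g k hg
    exact (hg.sub contDiff_const).sub (ContDiff.sum fun x _ => ((hχd x).pow 2).mul contDiff_const)
  have dP := hSd p (c / 2) hp
  have dQ := hSd q 0 hq
  have dR := hSd r (c / 2) hr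
  set eP := fun y => p y - c / 2 - ∑ x ∈ T, χ x y ^ 2 * (p x - c / 2) with hePd
  set eQ := fun y => q y - 0 - ∑ x ∈ T, χ x y ^ 2 * (q x - 0) with heQd
  set eR := fun y => r y - c / 2 - ∑ x ∈ T, χ x y ^ 2 * (r x - c / 2) with heRd
  obtain ⟨g1, dg1, pg1, hg1⟩ := pos_ext hC (fun y => c / 4 + eP y) (by fun_prop)
    (fun y hy => by have := abs_le.1 (hP y hy); simp only [hePd]; linarith)
  obtain ⟨g2, dg2, pg2, hg2⟩ := pos_ext hC (fun y => c / 4 + eR y) (by fun_prop)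
    (fun y hy => by have := abs_le.1 (hRr y hy); simp only [heRd]; linarith)
  obtain ⟨g3, dg3, pg3, hg3⟩ := pos_ext hC (fun y => c / 8 + eQ y / 2) (by fun_prop)
    (fun y hy => by have := abs_le.1 (hQ y hy); simp only [heQd]; linarith)
  obtain ⟨g4, dg4, pg4, hg4⟩ := pos_ext hC (fun y => c / 8 - eQ y / 2) (by fun_prop)
    (fun y hy => by have := abs_le.1 (hQ y hy); simp only [heQd]; linarith)
  have m1 := prim_pos g1 dg1 pg1 ![1, 0]
  have m2 := prim_pos g2 dg2 pg2 ![0, 1]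
  have m3 := prim_pos g3 dg3 pg3 ![1, 1]
  have m4 := prim_pos g4 dg4 pg4 ![1, -1]
  have m0 : (∑ x ∈ T, fun y (i j : Fin 2) =>
      χ x y ^ 2 * !![p x - c / 2, q x - 0; q x - 0, r x - c / 2] i j) ∈ Prim := by
    refine sum_mem fun x hx => prim_const (χ x) (hχd x) _ _ _ ?_ ?_
    · have := hpos x (hTC x hx) 1 0
      norm_num at this
      linarith
    · have h1 := hpos x (hTC x hx) 1 0
      have h2 := hpos x (hTC x hx) (q x) (-(p x - c / 2))
      norm_num at h1
      have h3 : 0 ≤ (p x - c / 2) * ((p x - c / 2) * (r x - c / 2) - (q x - 0) ^ 2) := by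
        have : 0 ≤ c / 2 * (q x ^ 2 + (p x - c / 2) ^ 2) := by positivity
        nlinarith
      exact nonneg_of_mul_nonneg_right h3 (by linarith)
  refine ach_congr (ach_of_prim hC (add_mem m0 (add_mem (add_mem m1 m2) (add_mem m3 m4)))) ?_
  intro y hy i j
  simp only [Pi.add_apply, Finset.sum_apply, hg1 y hy, hg2 y hy, hg3 y hy, hg4 y hy]
  fin_cases i <;> fin_cases j <;> simp [hePd, heQd, heRd] <;> ring


lemma bsup_le {C : Set (Fin 2 → ℝ)} {f : (Fin 2 → ℝ) → ℝ} {b : ℝ} (hb : 0 ≤ b)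
    (h : ∀ x ∈ C, f x ≤ b) : ⨆ x ∈ C, f x ≤ b :=
  Real.iSup_le (fun x => Real.iSup_le (fun hx => h x hx) hb) hb

lemma bsup_nonneg {C : Set (Fin 2 → ℝ)} {f : (Fin 2 → ℝ) → ℝ} (h : ∀ x, 0 ≤ f x) :
    0 ≤ ⨆ x ∈ C, f x :=
  Real.iSup_nonneg fun x => Real.iSup_nonneg fun _ => h x

lemma le_bsup {C : Set (Fin 2 → ℝ)} {f : (Fin 2 → ℝ) → ℝ} {a b : ℝ} (hb : 0 ≤ b)
    (h : ∀ x ∈ C, f x ≤ b) (hne : C.Nonempty) (ha : ∀ x ∈ C, a ≤ f x) : a ≤ ⨆ x ∈ C, f x := by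
  obtain ⟨x, hx⟩ := hne
  refine le_ciSup_of_le ⟨b, ?_⟩ x ?_
  · rintro _ ⟨y, rfl⟩
    exact Real.iSup_le (fun hy => h y hy) hb
  · rw [ciSup_pos hx]
    exact ha x hx

lemma antitone_bsup {C : Set (Fin 2 → ℝ)} (f : ℕ → (Fin 2 → ℝ) → ℝ)
    (hu : ∀ m, ∀ x ∈ C, f m x ≤ (1 / 4 : ℝ) ^ m + (1 / 4) ^ m / 4)
    (hl : ∀ m, ∀ x ∈ C, (1 / 4 : ℝ) ^ m - (1 / 4) ^ m / 4 ≤ f m x) :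
    Antitone fun m => ⨆ x ∈ C, f m x := by
  rcases C.eq_empty_or_nonempty with rfl | hne
  · intro m n _
    simp
  refine antitone_nat_of_succ_le fun m => ?_
  have h0 : ∀ m : ℕ, 0 < (1 / 4 : ℝ) ^ m := fun m => by positivity
  refine (bsup_le (by have := h0 (m + 1); linarith) (hu (m + 1))).trans ?_
  refine le_trans ?_ (le_bsup (by have := h0 m; linarith) (hu m) hne (hl m))
  have := h0 m
  rw [pow_succ]
  linarith

lemma retard (g : ℕ → ℕ → ℝ) (hg : ∀ k, Tendsto (g k) atTop (𝓝 0)) :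
    ∃ m : ℕ → ℕ, Monotone m ∧ Tendsto m atTop atTop ∧
      Tendsto (fun n => g (m n) n) atTop (𝓝 0) := by
  have h1 : ∀ k : ℕ, ∃ N, ∀ n ≥ N, |g k n| < 1 / ((k : ℝ) + 1) := by
    intro k
    have := Metric.tendsto_atTop.1 (hg k) (1 / ((k : ℝ) + 1)) (by positivity)
    simpa [Real.dist_eq] using this
  choose N hN using h1
  have hle : ∀ k n, max (N k) k ≤ n → k ≤ Nat.findGreatest (fun k => N k ≤ n) n := fun k n h =>
    Nat.le_findGreatest ((le_max_right _ _).trans h) ((le_max_left _ _).trans h)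
  have hsp : ∀ k n, max (N k) k ≤ n → N (Nat.findGreatest (fun k => N k ≤ n) n) ≤ n := fun k n h =>
    Nat.findGreatest_spec (P := fun k => N k ≤ n) ((le_max_right _ _).trans h)
      ((le_max_left _ _).trans h)
  refine ⟨fun n => Nat.findGreatest (fun k => N k ≤ n) n, ?_, ?_, ?_⟩
  · intro a b hab
    exact Nat.findGreatest_mono (fun k hk => le_trans hk hab) hab
  · exact tendsto_atTop.2 fun k => eventually_atTop.2 ⟨max (N k) k, fun n hn => hle k n hn⟩
  · rw [Metric.tendsto_atTop]
    intro ε hε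
    obtain ⟨k, hk⟩ := exists_nat_one_div_lt hε
    refine ⟨max (N k) k, fun n hn => ?_⟩
    rw [Real.dist_eq, sub_zero]
    refine (hN _ n (hsp k n hn)).trans (lt_of_le_of_lt ?_ hk)
    have : (k : ℝ) ≤ (Nat.findGreatest (fun k => N k ≤ n) n : ℕ) := by exact_mod_cast hle k n hn
    exact one_div_le_one_div_of_le (by positivity) (by linarith)

lemma opnorm_le {E : Type*} [NormedAddCommGroup E] [NormedSpace ℝ E]
    (L : (Fin 2 → ℝ) →L[ℝ] E) (K : ℝ) (hK : 0 ≤ K) (h : ∀ i, ‖L (Pi.single i 1)‖ ≤ K) :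
    ‖L‖ ≤ 2 * K := by
  refine L.opNorm_le_bound (by positivity) fun x => ?_
  have hx : x = x 0 • (Pi.single 0 1 : Fin 2 → ℝ) + x 1 • (Pi.single 1 1 : Fin 2 → ℝ) := by
    ext i; fin_cases i <;> simp
  have h0 := norm_le_pi_norm x 0
  have h1 := norm_le_pi_norm x 1
  calc ‖L x‖ = ‖x 0 • L (Pi.single 0 1) + x 1 • L (Pi.single 1 1)‖ := by
        conv_lhs => rw [hx]
        simp
    _ ≤ ‖x 0‖ * ‖L (Pi.single 0 1)‖ + ‖x 1‖ * ‖L (Pi.single 1 1)‖ := by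
        refine (norm_add_le _ _).trans ?_
        rw [norm_smul, norm_smul]
    _ ≤ ‖x‖ * K + ‖x‖ * K := by
        gcongr
        · exact h 0
        · exact h 1
    _ = 2 * K * ‖x‖ := by ring

lemma frob_le (M : Matrix (Fin 2) (Fin 2) ℝ) (ε : ℝ) (hε : 0 ≤ ε) (h : ∀ i j, |M i j| ≤ ε) :
    ‖M‖ ≤ 2 * ε := by
  rw [Matrix.frobenius_norm_def, ← Real.sqrt_eq_rpow]
  refine Real.sqrt_le_iff.2 ⟨by positivity, ?_⟩
  have : ∀ i j, ‖M i j‖ ^ (2 : ℝ) ≤ ε ^ 2 := by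
    intro i j
    rw [Real.rpow_two]
    exact pow_le_pow_left₀ (norm_nonneg _) (h i j) 2
  simp only [Fin.sum_univ_two]
  have h1 := this 0 0
  have h2 := this 0 1
  have h3 := this 1 0
  have h4 := this 1 1
  nlinarith

lemma fderiv_coord {w : (Fin 2 → ℝ) → Fin 2 → ℝ} (hw : ContDiff ℝ (⊤ : ℕ∞) w)
    (x u : Fin 2 → ℝ) (j : Fin 2) : fderiv ℝ w x u j = fderiv ℝ (fun y => w y j) x u := by
  have h := (hw.differentiable (by simp) x).hasFDerivAt
  have := (hasFDerivAt_pi'.1 h j).fderiv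
  rw [this]; rfl

lemma tendsto_of_le_quarter (F : ℕ → ℝ) (K : ℝ) (h0 : ∀ m, 0 ≤ F m)
    (h : ∀ m, F m ≤ K * (1 / 4 : ℝ) ^ m) : Tendsto F atTop (𝓝 0) := by
  have : Tendsto (fun m : ℕ => K * (1 / 4 : ℝ) ^ m) atTop (𝓝 0) := by
    simpa using (tendsto_pow_atTop_nhds_zero_of_lt_one (by norm_num : (0 : ℝ) ≤ 1 / 4)
      (by norm_num)).const_mul K
  exact squeeze_zero h0 h this

/-- **Lemma 6 of the paper** (convex-integration decomposition, after Lewicka–Pakzad,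
with a retardation argument). Given a smooth uniformly positive definite symmetric
matrix field `A` on `Ω̄` and `h_n → 0⁺`, there are smooth `v_n, w_n` with
`A − (½∇v_n⊗∇v_n + sym∇w_n) → 0` uniformly, `sup|v_n| → 0` and `sup|w_n| → 0`
monotonically, uniformly bounded first derivatives, and
`h_n^{1/2} sup‖∇²v_n‖ + h_n sup‖∇²w_n‖ → 0`. -/
theorem stmt10 (Ω : Set (Fin 2 → ℝ)) (hΩo : IsOpen Ω) (hΩb : Bornology.IsBounded Ω)
    (c : ℝ) (hc : 0 < c)
    (A : (Fin 2 → ℝ) → Matrix (Fin 2) (Fin 2) ℝ) (hA : ContDiff ℝ (⊤ : ℕ∞) A)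
    (hAsym : ∀ x ∈ closure Ω, (A x)ᵀ = A x)
    (hApos : ∀ x ∈ closure Ω, ∀ ξ : Fin 2 → ℝ, c * ∑ i, ξ i ^ 2 ≤ ξ ⬝ᵥ (A x).mulVec ξ)
    (h : ℕ → ℝ) (hh : ∀ n, 0 < h n) (hh0 : Tendsto h atTop (𝓝 0)) :
    ∃ (v : ℕ → (Fin 2 → ℝ) → ℝ) (w : ℕ → (Fin 2 → ℝ) → Fin 2 → ℝ),
      (∀ n, ContDiff ℝ (⊤ : ℕ∞) (v n)) ∧ (∀ n, ContDiff ℝ (⊤ : ℕ∞) (w n)) ∧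
      Tendsto (fun n => ⨆ x ∈ closure Ω,
          ‖A x - ((1 / 2 : ℝ) • gradOuter (v n) x + symGrad (w n) x)‖)
        atTop (𝓝 0) ∧
      (Antitone fun n => ⨆ x ∈ closure Ω, |v n x|) ∧
      Tendsto (fun n => ⨆ x ∈ closure Ω, |v n x|) atTop (𝓝 0) ∧
      (Antitone fun n => ⨆ x ∈ closure Ω, ‖w n x‖) ∧
      Tendsto (fun n => ⨆ x ∈ closure Ω, ‖w n x‖) atTop (𝓝 0) ∧
      (∃ K : ℝ, ∀ n, ∀ x ∈ closure Ω, ‖fderiv ℝ (v n) x‖ + ‖fderiv ℝ (w n) x‖ ≤ K) ∧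
      Tendsto (fun n =>
          Real.sqrt (h n) * (⨆ x ∈ closure Ω, ‖iteratedFDeriv ℝ 2 (v n) x‖) +
            h n * (⨆ x ∈ closure Ω, ‖iteratedFDeriv ℝ 2 (w n) x‖))
        atTop (𝓝 0) := by
  have hC : IsCompact (closure Ω) := hΩb.isCompact_closure
  have hent : ∀ i j, ContDiff ℝ (⊤ : ℕ∞) (fun x => A x i j) := fun i j =>
    ((Matrix.entryLinearMap ℝ ℝ i j).toContinuousLinearMap.contDiff).comp hA
  obtain ⟨K, hK0, hK⟩ := exists_decomp hC c hc (fun x => A x 0 0) (fun x => A x 0 1)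
    (fun x => A x 1 1) (hent 0 0) (hent 0 1) (hent 1 1) (by
      intro x hx s t
      have h1 := hApos x hx ![s, t]
      have h2 : A x 1 0 = A x 0 1 := congrFun (congrFun (hAsym x hx) 0) 1
      simp [Matrix.mulVec, dotProduct, Fin.sum_univ_two, h2] at h1
      linarith)
  have hq : ∀ m : ℕ, 0 < (1 / 4 : ℝ) ^ m := fun m => by positivity
  choose V W hV hW hVW using fun m : ℕ => hK ((1 / 4) ^ m / 4) (by have := hq m; linarith)
  let V' : ℕ → (Fin 2 → ℝ) → ℝ := fun m x => V m x + (1 / 4) ^ m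
  let W' : ℕ → (Fin 2 → ℝ) → Fin 2 → ℝ := fun m x j => W m j x + (1 / 4) ^ m
  have hV' : ∀ m, ContDiff ℝ (⊤ : ℕ∞) (V' m) := fun m => (hV m).add contDiff_const
  have hW' : ∀ m, ContDiff ℝ (⊤ : ℕ∞) (W' m) := fun m =>
    contDiff_pi.2 fun j => (hW m j).add contDiff_const
  have gV : ∀ m x i, gradv (V' m) x i = gradv (V m) x i := by
    intro m x i
    simp only [gradv, V', fderiv_add_const]
  have gW : ∀ m x i j, fderiv ℝ (W' m) x (Pi.single i 1) j = gradv (W m j) x i := by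
    intro m x i j
    rw [fderiv_coord (hW' m)]
    simp only [gradv, W', fderiv_add_const]
  have hD : ∀ m, ∃ D : ℝ, 0 ≤ D ∧ ∀ x ∈ closure Ω, ‖iteratedFDeriv ℝ 2 (V' m) x‖ ≤ D ∧
      ‖iteratedFDeriv ℝ 2 (W' m) x‖ ≤ D := by
    intro m
    obtain ⟨D1, h1⟩ := hC.exists_bound_of_continuousOn
      ((hV' m).continuous_iteratedFDeriv (m := 2)
        (WithTop.coe_le_coe.2 (le_top : ((2 : ℕ) : ℕ∞) ≤ ⊤))).continuousOn
    obtain ⟨D2, h2⟩ := hC.exists_bound_of_continuousOn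
      ((hW' m).continuous_iteratedFDeriv (m := 2)
        (WithTop.coe_le_coe.2 (le_top : ((2 : ℕ) : ℕ∞) ≤ ⊤))).continuousOn
    refine ⟨max 0 (max D1 D2), le_max_left _ _, fun x hx => ⟨?_, ?_⟩⟩
    · exact (h1 x hx).trans ((le_max_left _ _).trans (le_max_right _ _))
    · exact (h2 x hx).trans ((le_max_right _ _).trans (le_max_right _ _))
  choose D hD0 hDb using hD
  have hs0 : Tendsto (fun n => Real.sqrt (h n)) atTop (𝓝 0) := by
    have := (Real.continuous_sqrt.tendsto 0).comp hh0
    rw [Real.sqrt_zero] at this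
    exact this
  obtain ⟨m, hm, hmt, hmg⟩ := retard (fun k n => Real.sqrt (h n) * D k + h n * D k) (fun k => by
    simpa using (hs0.mul_const (D k)).add (hh0.mul_const (D k)))
  have vb : ∀ k, ∀ x ∈ closure Ω, |V' k x| ≤ (1 / 4 : ℝ) ^ k + (1 / 4) ^ k / 4 ∧
      (1 / 4 : ℝ) ^ k - (1 / 4) ^ k / 4 ≤ |V' k x| := by
    intro k x hx
    have h1 := abs_le.1 (hVW k x hx).1
    have := hq k
    have h3 : 0 ≤ V' k x := by simp only [V']; linarith
    rw [abs_of_nonneg h3]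
    simp only [V']
    constructor <;> linarith
  have wb : ∀ k, ∀ x ∈ closure Ω, ‖W' k x‖ ≤ (1 / 4 : ℝ) ^ k + (1 / 4) ^ k / 4 ∧
      (1 / 4 : ℝ) ^ k - (1 / 4) ^ k / 4 ≤ ‖W' k x‖ := by
    intro k x hx
    have h1 := fun j => abs_le.1 ((hVW k x hx).2.1 j)
    have := hq k
    constructor
    · refine (pi_norm_le_iff_of_nonneg (by linarith)).2 fun j => ?_
      rw [Real.norm_eq_abs, abs_le]
      have := h1 j
      simp only [W']
      constructor <;> linarith
    · refine le_trans ?_ (norm_le_pi_norm (W' k x) 0)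
      refine le_trans ?_ (le_abs_self _)
      have := h1 0
      simp only [W']
      linarith
  have tV : Tendsto (fun k => ⨆ x ∈ closure Ω, |V' k x|) atTop (𝓝 0) :=
    tendsto_of_le_quarter _ 2 (fun k => bsup_nonneg fun x => abs_nonneg _) fun k =>
      bsup_le (by have := hq k; linarith) fun x hx => ((vb k x hx).1).trans
        (by have := hq k; linarith)
  have tW : Tendsto (fun k => ⨆ x ∈ closure Ω, ‖W' k x‖) atTop (𝓝 0) :=
    tendsto_of_le_quarter _ 2 (fun k => bsup_nonneg fun x => norm_nonneg _) fun k =>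
      bsup_le (by have := hq k; linarith) fun x hx => ((wb k x hx).1).trans
        (by have := hq k; linarith)
  have aV : Antitone (fun k => ⨆ x ∈ closure Ω, |V' k x|) :=
    antitone_bsup (fun k x => |V' k x|) (fun k x hx => (vb k x hx).1) (fun k x hx => (vb k x hx).2)
  have aW : Antitone (fun k => ⨆ x ∈ closure Ω, ‖W' k x‖) :=
    antitone_bsup (fun k x => ‖W' k x‖) (fun k x hx => (wb k x hx).1) (fun k x hx => (wb k x hx).2)
  have tA : Tendsto (fun k => ⨆ x ∈ closure Ω,
      ‖A x - ((1 / 2 : ℝ) • gradOuter (V' k) x + symGrad (W' k) x)‖) atTop (𝓝 0) := by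
    refine tendsto_of_le_quarter _ 1 (fun k => bsup_nonneg fun x => norm_nonneg _) fun k =>
      bsup_le (by have := hq k; linarith) fun x hx => ?_
    refine (frob_le _ ((1 / 4) ^ k / 4) (by have := hq k; linarith) fun i j => ?_).trans
      (by have := hq k; linarith)
    have h1 := (hVW k x hx).2.2.2.2 i j
    have h2 : A x 1 0 = A x 0 1 := congrFun (congrFun (hAsym x hx) 0) 1
    have h3 : (!![A x 0 0, A x 0 1; A x 0 1, A x 1 1] : Matrix (Fin 2) (Fin 2) ℝ) i j = A x i j := by
      fin_cases i <;> fin_cases j <;> simp [h2]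
    simp only [h3] at h1
    refine le_trans (le_of_eq ?_) h1
    simp [gradOuter, symGrad, gV, gW]
  refine ⟨fun n => V' (m n), fun n => W' (m n), fun n => hV' _, fun n => hW' _,
    tA.comp hmt, aV.comp_monotone hm, tV.comp hmt, aW.comp_monotone hm, tW.comp hmt,
    ⟨2 * K + 2 * K, fun n x hx => ?_⟩, ?_⟩
  · obtain ⟨-, -, b2, b3, -⟩ := hVW (m n) x hx
    refine add_le_add (opnorm_le _ K hK0 fun i => ?_) (opnorm_le _ K hK0 fun i => ?_)
    · have := b2 i
      rw [← gV] at this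
      exact this
    · refine (pi_norm_le_iff_of_nonneg hK0).2 fun j => ?_
      rw [gW]
      exact b3 i j
  · refine squeeze_zero (fun n => ?_) (fun n => ?_) hmg
    · exact add_nonneg (mul_nonneg (Real.sqrt_nonneg _) (bsup_nonneg fun x => norm_nonneg _))
        (mul_nonneg (hh n).le (bsup_nonneg fun x => norm_nonneg _))
    · refine add_le_add (mul_le_mul_of_nonneg_left ?_ (Real.sqrt_nonneg _))
        (mul_le_mul_of_nonneg_left ?_ (hh n).le)
      · exact bsup_le (hD0 _) fun x hx => (hDb (m n) x hx).1
      · exact bsup_le (hD0 _) fun x hx => (hDb (m n) x hx).2
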